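/- liminf_{n→∞} σ*(φ*(n))/n ≤ 1/4 + 3/(4·(2³² − 1)). -/

import Mathlib

open Filter Real

/-- The sum of the unitary divisors of `n`: `σ*(p₁^{a₁} ⋯ p_r^{a_r}) = ∏ (p_i^{a_i} + 1)`. -/
def usigma (n : ℕ) : ℕ := n.factorization.prod fun p a => p ^ a + 1

/-- The unitary Euler function: `φ*(p₁^{a₁} ⋯ p_r^{a_r}) = ∏ (p_i^{a_i} - 1)`. -/
def uphi (n : ℕ) : ℕ := n.factorization.prod fun p a => p ^ a - 1

theorem usigma_mul_of_coprime {m n : ℕ} (h : m.Coprime n) :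
    usigma (m * n) = usigma m * usigma n := by
  unfold usigma
  rw [Nat.factorization_mul_of_coprime h]
  exact Finsupp.prod_add_index_of_disjoint h.disjoint_primeFactors _

theorem uphi_mul_of_coprime {m n : ℕ} (h : m.Coprime n) :
    uphi (m * n) = uphi m * uphi n := by
  unfold uphi
  rw [Nat.factorization_mul_of_coprime h]
  exact Finsupp.prod_add_index_of_disjoint h.disjoint_primeFactors _

theorem usigma_prime_pow {p k : ℕ} (hp : p.Prime) (hk : k ≠ 0) :
    usigma (p ^ k) = p ^ k + 1 := by
  rw [usigma, hp.factorization_pow, Finsupp.prod, Finsupp.support_single _ hk]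
  simp

theorem uphi_prime_pow {p k : ℕ} (hp : p.Prime) (hk : k ≠ 0) :
    uphi (p ^ k) = p ^ k - 1 := by
  rw [uphi, hp.factorization_pow, Finsupp.prod, Finsupp.support_single _ hk]
  simp

theorem uphi_prime {p : ℕ} (hp : p.Prime) : uphi p = p - 1 := by
  simpa using uphi_prime_pow hp one_ne_zero

/-- If `m ≤ B ^ a` has no prime factor below `a`, then `σ*(m) ≤ m · exp (log B / log a)`. -/
theorem usigma_le_mul_exp {m a B : ℕ} (hm : m ≠ 0) (ha : 1 < a)
    (hq : ∀ q ∈ m.primeFactors, a ≤ q) (hB : m ≤ B ^ a) :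
    (usigma m : ℝ) ≤ m * exp (log B / log a) := by
  have ha0 : (0 : ℝ) < a := by positivity
  have hla : 0 < log (a : ℝ) := log_pos (by exact_mod_cast ha)
  have hprod : (m : ℝ) = ∏ q ∈ m.primeFactors, (q : ℝ) ^ m.factorization q := by
    conv_lhs => rw [← Nat.prod_factorization_pow_eq_self hm]
    rw [Finsupp.prod, Nat.support_factorization]
    push_cast
    rfl
  have hle : ∀ q ∈ m.primeFactors, (a : ℝ) ≤ (q : ℝ) ^ m.factorization q := by
    intro q hqm
    have hpos := (Nat.prime_of_mem_primeFactors hqm).factorization_pos_of_dvd hm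
      (Nat.dvd_of_mem_primeFactors hqm)
    exact_mod_cast (hq q hqm).trans (Nat.le_self_pow hpos.ne' q)
  have hcard : (a : ℝ) ^ m.primeFactors.card ≤ (B : ℝ) ^ a := by
    refine le_trans ?_ (show (m : ℝ) ≤ _ by exact_mod_cast hB)
    rw [hprod, ← Finset.prod_const]
    exact Finset.prod_le_prod (fun _ _ => ha0.le) hle
  have hexp : (m.primeFactors.card : ℝ) * (1 / a) ≤ log B / log a := by
    have h := log_le_log (by positivity) hcard
    rw [log_pow, log_pow] at h
    rw [mul_one_div, div_le_div_iff₀ ha0 hla]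
    linarith
  calc (usigma m : ℝ)
      = ∏ q ∈ m.primeFactors, ((q : ℝ) ^ m.factorization q + 1) := by
        rw [usigma, Finsupp.prod, Nat.support_factorization]
        push_cast
        rfl
    _ ≤ ∏ q ∈ m.primeFactors, (q : ℝ) ^ m.factorization q * exp (1 / a) := by
        refine Finset.prod_le_prod (fun _ _ => by positivity) fun q hqm => ?_
        have h1 := add_one_le_exp (1 / (a : ℝ))
        have h2 : 1 ≤ (q : ℝ) ^ m.factorization q * (1 / a) := by
          rw [mul_one_div, one_le_div ha0]
          exact hle q hqm
        have h3 := ha0.trans_le (hle q hqm)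
        nlinarith
    _ = m * exp (m.primeFactors.card * (1 / a)) := by
        rw [Finset.prod_mul_distrib, ← hprod, Finset.prod_const, ← exp_nat_mul]
    _ ≤ m * exp (log B / log a) := by gcongr

/-- For primes `p ≤ a`, the prime factors of `1 + p + ⋯ + p ^ (a - 1)` exceed `a`. -/
theorem lt_of_prime_dvd_geom_sum {p a q : ℕ} (hp : 1 < p) (ha : a.Prime) (hpa : p ≤ a)
    (hq : q.Prime) (h : q ∣ ∑ i ∈ Finset.range a, p ^ i) : a < q := by
  have := Fact.mk hq
  have := Fact.mk ha
  have hsum : ∑ i ∈ Finset.range a, (p : ZMod q) ^ i = 0 := by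
    have h0 := (ZMod.natCast_eq_zero_iff _ q).2 h
    exact_mod_cast h0
  have hpow : (p : ZMod q) ^ a = 1 := by
    have := geom_sum_mul (p : ZMod q) a
    rw [hsum, zero_mul] at this
    exact (sub_eq_zero.1 this.symm)
  have hp1 : (p : ZMod q) ≠ 1 := by
    intro hp1
    rw [hp1] at hsum
    simp only [one_pow, Finset.sum_const, Finset.card_range, nsmul_eq_mul, mul_one] at hsum
    have hqa : q = a := (Nat.prime_dvd_prime_iff_eq hq ha).1 ((ZMod.natCast_eq_zero_iff _ _).1 hsum)
    have hdvd : q ∣ p - 1 := by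
      rw [← ZMod.natCast_eq_zero_iff, Nat.cast_sub hp.le, hp1]
      simp
    have := Nat.le_of_dvd (by omega) hdvd
    omega
  have hord : orderOf (p : ZMod q) = a := orderOf_eq_prime hpow hp1
  have hp0 : (p : ZMod q) ≠ 0 := by
    intro h0
    rw [h0, zero_pow ha.ne_zero] at hpow
    exact zero_ne_one hpow
  have hdvd := ZMod.orderOf_dvd_card_sub_one hp0
  rw [hord] at hdvd
  have := Nat.le_of_dvd (by have := hq.two_le; omega) hdvd
  have := hq.two_le
  omega

theorem prime_two_mul_three_pow_add_one : Nat.Prime (2 * 3 ^ 30 + 1) := by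
  refine lucas_primality _ 10 ?_ ?_
  · norm_num only
    reduce_mod_char
  · intro q hq hd
    rw [Nat.add_sub_cancel, hq.dvd_mul] at hd
    rcases hd with hd | hd
    · rw [(Nat.prime_dvd_prime_iff_eq hq Nat.prime_two).1 hd]
      norm_num only
      reduce_mod_char
      decide
    · rw [(Nat.prime_dvd_prime_iff_eq hq Nat.prime_three).1 (hq.dvd_of_dvd_pow hd)]
      norm_num only
      reduce_mod_char
      decide

theorem uphi_two_mul_prod_fermat_primes : uphi (2 * (2 ^ 32 - 1)) = 2 ^ 31 := by
  rw [show 2 * (2 ^ 32 - 1) = 2 * (3 * (5 * (17 * (257 * 65537)))) by norm_num,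
    uphi_mul_of_coprime (by norm_num), uphi_mul_of_coprime (by norm_num),
    uphi_mul_of_coprime (by norm_num), uphi_mul_of_coprime (by norm_num),
    uphi_mul_of_coprime (by norm_num), uphi_prime (by norm_num), uphi_prime (by norm_num),
    uphi_prime (by norm_num), uphi_prime (by norm_num), uphi_prime (by norm_num),
    uphi_prime (by norm_num)]
  norm_num

theorem usigma_uphi_two_mul_prod_fermat_primes_mul {p a : ℕ} (hp : p = 2 * 3 ^ 30 + 1)
    (ha : a.Prime) (hpa : p ≤ a) :
    usigma (uphi (2 * (2 ^ 32 - 1) * p ^ a)) =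
      (2 ^ 32 + 1) * ((3 ^ 30 + 1) * usigma (∑ i ∈ Finset.range a, p ^ i)) := by
  have hpp : p.Prime := hp ▸ prime_two_mul_three_pow_add_one
  have hcop : ∀ r : ℕ, r.Prime → r ≤ 3 → r.Coprime (∑ i ∈ Finset.range a, p ^ i) := by
    intro r hr hr3
    refine (hr.coprime_iff_not_dvd).2 fun hd => ?_
    have := lt_of_prime_dvd_geom_sum hpp.one_lt ha hpa hr hd
    omega
  have h2 := hcop 2 Nat.prime_two (by norm_num)
  have h3 := hcop 3 Nat.prime_three le_rfl
  have hgeom : p ^ a - 1 = 2 * 3 ^ 30 * ∑ i ∈ Finset.range a, p ^ i := by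
    have := Nat.geomSum_eq hpp.two_le a
    have hd : p - 1 ∣ p ^ a - 1 := by simpa using Nat.sub_dvd_pow_sub_pow p 1 a
    rw [this, ← show p - 1 = 2 * 3 ^ 30 by omega, Nat.mul_div_cancel' hd]
  have hc : Nat.Coprime (2 * (2 ^ 32 - 1)) (p ^ a) := by
    refine Nat.Coprime.pow_right _ ?_
    rw [hp]
    norm_num
  rw [uphi_mul_of_coprime hc, uphi_two_mul_prod_fermat_primes, uphi_prime_pow hpp ha.ne_zero, hgeom,
    show ∀ x : ℕ, 2 ^ 31 * (2 * 3 ^ 30 * x) = 2 ^ 32 * (3 ^ 30 * x) by intro x; ring,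
    usigma_mul_of_coprime (Nat.Coprime.mul_right (by norm_num) (h2.pow_left _)),
    usigma_mul_of_coprime (h3.pow_left _), usigma_prime_pow Nat.prime_two (by norm_num),
    usigma_prime_pow Nat.prime_three (by norm_num)]

theorem frequently_usigma_uphi_le :
    ∃ᶠ n : ℕ in atTop, (usigma (uphi n) : ℝ) / n ≤ 1 / 4 + 3 / (4 * (2 ^ 32 - 1)) := by
  obtain ⟨p, hp⟩ : ∃ p : ℕ, p = 2 * 3 ^ 30 + 1 := ⟨_, rfl⟩
  have hpp : p.Prime := hp ▸ prime_two_mul_three_pow_add_one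
  have hlim : Tendsto (fun a : ℕ => exp (log p / log a)) atTop (nhds 1) := by
    have h := (tendsto_log_atTop.comp tendsto_natCast_atTop_atTop).const_div_atTop (log p)
    simpa [Function.comp_def] using (continuous_exp.tendsto 0).comp h
  obtain ⟨A, hA⟩ := eventually_atTop.1
    (hlim.eventually (eventually_le_nhds (show (1 : ℝ) < 1 + 1 / 2 ^ 33 by norm_num)))
  refine frequently_atTop.2 fun N => ?_
  obtain ⟨a, haN, ha⟩ := Nat.exists_infinite_primes (max N (max A p))
  have hNa : N ≤ a := (le_max_left _ _).trans haN
  have hAa : A ≤ a := (le_max_left _ _).trans ((le_max_right _ _).trans haN)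
  have hpa : p ≤ a := (le_max_right _ _).trans ((le_max_right _ _).trans haN)
  refine ⟨2 * (2 ^ 32 - 1) * p ^ a, ?_, ?_⟩
  · have := a.lt_pow_self hpp.one_lt
    omega
  · rw [usigma_uphi_two_mul_prod_fermat_primes_mul hp ha hpa]
    set m := ∑ i ∈ Finset.range a, p ^ i with hm
    have hgeom : m * (2 * 3 ^ 30) + 1 = p ^ a := by
      have := geom_sum_mul_add (2 * 3 ^ 30) a
      rwa [← hp, ← hm] at this
    have hm0 : m ≠ 0 := by
      intro h0
      rw [h0, zero_mul, zero_add] at hgeom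
      exact (Nat.one_lt_pow ha.ne_zero hpp.one_lt).ne hgeom
    have hσ : (usigma m : ℝ) ≤ m * (1 + 1 / 2 ^ 33) := by
      refine (usigma_le_mul_exp hm0 ha.one_lt (fun q hq => ?_) (B := p) (by omega)).trans
        (mul_le_mul_of_nonneg_left (hA a hAa) (Nat.cast_nonneg m))
      exact (lt_of_prime_dvd_geom_sum hpp.one_lt ha hpa (Nat.prime_of_mem_primeFactors hq)
        (Nat.dvd_of_mem_primeFactors hq)).le
    have hgeomR : (p : ℝ) ^ a = m * (2 * 3 ^ 30) + 1 := by exact_mod_cast hgeom.symm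
    have hmR : (0 : ℝ) ≤ m := Nat.cast_nonneg m
    rw [div_le_iff₀ (by have := hpp.pos; positivity)]
    push_cast
    rw [hgeomR]
    norm_num at hσ ⊢
    linarith

theorem liminf_usigma_uphi_le :
    liminf (fun n : ℕ => (usigma (uphi n) : ℝ) / n) atTop
      ≤ 1 / 4 + 3 / (4 * (2 ^ 32 - 1)) := by
  refine liminf_le_of_frequently_le frequently_usigma_uphi_le ?_
  exact isBoundedUnder_of ⟨0, fun n => by positivity⟩
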